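/- Let M be a compact smooth m-manifold in R^d with reach at least 1, P a uniform (ε,κ)-sample of M, x a point at distance at most 2ε from M, γ = 4ε, and r = √m·ε/3. Then Σ_{p ∈ P ∩ B(x, mγ)} (1 − ‖x−p‖/(mγ))^{2m−1} ≤ (23κ + 1) · Σ_{p ∈ P ∩ B(x, mγ − r)} (1 − ‖x−p‖/(mγ))^{2m−1}. -/

import Mathlib

open Set Metric

/-- The medial axis of a set `M`. -/
def medialAxis {d : ℕ} (M : Set (EuclideanSpace ℝ (Fin d))) : Set (EuclideanSpace ℝ (Fin d)) :=
  closure {x | ∃ y ∈ M, ∃ z ∈ M, y ≠ z ∧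
    dist x y = Metric.infDist x M ∧ dist x z = Metric.infDist x M}

open Filter Topology in
theorem exists_infDist_ge_of_unique_nearest {F : Type*} [NormedAddCommGroup F]
    [InnerProductSpace ℝ F] [ProperSpace F] {M : Set F} (hMc : IsCompact M) (hMne : M.Nonempty)
    (hM : ∀ u, infDist u M < 1 → ∀ y ∈ M, ∀ y' ∈ M,
      dist u y = infDist u M → dist u y' = infDist u M → y = y')
    {q : F} (hq : 0 < infDist q M) {L η : ℝ} (hL : 0 ≤ L) (hqL : infDist q M + L < 1)
    (hη : 0 < η) (hη1 : η ≤ 1) :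
    ∃ u, dist u q = L ∧ infDist q M + (1 - η) * L ≤ infDist u M := by
  have hcont : Continuous fun u => infDist u M - (1 - η) * dist u q :=
    (continuous_infDist_pt M).sub (continuous_const.mul (continuous_id.dist continuous_const))
  obtain ⟨u, huL, humax⟩ := (isCompact_closedBall q L).exists_isMaxOn
    ⟨q, mem_closedBall_self hL⟩ hcont.continuousOn
  have hgq : infDist q M ≤ infDist u M - (1 - η) * dist u q := by
    simpa using humax (mem_closedBall_self hL)
  rw [mem_closedBall] at huL
  rcases huL.eq_or_lt with huL | huL
  · exact ⟨u, huL, by rw [huL] at hgq; linarith⟩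
  exfalso
  have hu0 : 0 < infDist u M :=
    hq.trans_le (hgq.trans (sub_le_self _ (mul_nonneg (by linarith) dist_nonneg)))
  have hu1 : infDist u M < 1 := by
    have := infDist_le_infDist_add_dist (s := M) (x := u) (y := q)
    linarith
  obtain ⟨p, hpM, hp⟩ := hMc.exists_infDist_eq_dist hMne u
  have hup : 0 < ‖u - p‖ := by rw [← dist_eq_norm, ← hp]; exact hu0
  set v : F := ‖u - p‖⁻¹ • (u - p) with hv
  have hvn : ‖v‖ = 1 := by
    rw [hv, norm_smul, norm_inv, norm_norm, inv_mul_cancel₀ hup.ne']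
  let h : ℕ → ℝ := fun n => (L - dist u q) / (n + 1)
  have hpos : ∀ n, 0 < h n := fun n => by
    have : 0 < L - dist u q := by linarith
    positivity
  have hh0 : Tendsto h atTop (𝓝 0) := by
    have := (tendsto_one_div_add_atTop_nhds_zero_nat (𝕜 := ℝ)).const_mul (L - dist u q)
    simpa [h, div_eq_mul_inv] using this
  choose p' hp'M hp' using fun n => hMc.exists_infDist_eq_dist hMne (u + h n • v)
  have hdist : ∀ n, dist (u + h n • v) u = h n := fun n => by
    rw [dist_eq_norm, add_sub_cancel_left, norm_smul, hvn, mul_one, Real.norm_of_nonneg (hpos n).le]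
  have hinner : ∀ n, inner ℝ v (u - p' n) ≤ (1 - η) * ‖u - p' n‖ := by
    intro n
    have hhL : h n ≤ L - dist u q := div_le_self (by linarith) (by simp)
    have hq' := dist_triangle (u + h n • v) u q
    rw [hdist] at hq'
    have hmax : infDist (u + h n • v) M - (1 - η) * dist (u + h n • v) q
        ≤ infDist u M - (1 - η) * dist u q :=
      humax (mem_closedBall.2 (by linarith : dist (u + h n • v) q ≤ L))
    have hincr : infDist (u + h n • v) M ≤ infDist u M + (1 - η) * h n := by
      nlinarith [mul_le_mul_of_nonneg_left hq' (sub_nonneg.2 hη1)]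
    have hle : infDist u M ≤ ‖u - p' n‖ := by
      rw [← dist_eq_norm]; exact infDist_le_dist_of_mem (hp'M n)
    have hcs := real_inner_le_norm (u + h n • v - p' n) (u - p' n)
    have hexp : inner ℝ (u + h n • v - p' n) (u - p' n)
        = ‖u - p' n‖ ^ 2 + h n * inner ℝ v (u - p' n) := by
      rw [add_sub_right_comm, inner_add_left, real_inner_self_eq_norm_sq, real_inner_smul_left]
    rw [hexp, ← dist_eq_norm (u + h n • v), ← hp'] at hcs
    have : h n * inner ℝ v (u - p' n) ≤ h n * ((1 - η) * ‖u - p' n‖) := by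
      nlinarith [norm_nonneg (u - p' n)]
    exact le_of_mul_le_mul_left this (hpos n)
  obtain ⟨a, haM, φ, hφ, ha⟩ := hMc.tendsto_subseq hp'M
  have hlim : Tendsto (fun n => u + h (φ n) • v) atTop (𝓝 u) := by
    have := (tendsto_const_nhds (x := u)).add
      ((hh0.comp hφ.tendsto_atTop).smul (tendsto_const_nhds (x := v)))
    simpa using this
  have hap : dist u a = infDist u M := by
    refine tendsto_nhds_unique (hlim.dist ha) ?_
    refine (((continuous_infDist_pt M).tendsto u).comp hlim).congr fun n => ?_
    exact hp' (φ n)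
  obtain rfl := hM u hu1 a haM p hpM hap hp.symm
  have hfin : inner ℝ v (u - a) ≤ (1 - η) * ‖u - a‖ :=
    le_of_tendsto_of_tendsto (tendsto_const_nhds.inner (tendsto_const_nhds.sub ha))
      ((tendsto_const_nhds.sub ha).norm.const_mul _) (Eventually.of_forall fun n => hinner (φ n))
  rw [hv, real_inner_smul_left, real_inner_self_eq_norm_sq, sq, inv_mul_cancel_left₀ hup.ne'] at hfin
  nlinarith

theorem infDist_add_smul_of_unique_nearest {F : Type*} [NormedAddCommGroup F]
    [InnerProductSpace ℝ F] [ProperSpace F] {M : Set F} (hMc : IsCompact M)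
    (hM : ∀ u, infDist u M < 1 → ∀ y ∈ M, ∀ y' ∈ M,
      dist u y = infDist u M → dist u y' = infDist u M → y = y')
    {q p : F} (hpM : p ∈ M) (hp : dist q p = infDist q M) (hq : 0 < infDist q M) {t : ℝ}
    (hqt : infDist q M ≤ t) (ht : t < 1) :
    infDist (p + (t / ‖q - p‖) • (q - p)) M = t := by
  have hMne : M.Nonempty := ⟨p, hpM⟩
  set e := infDist q M with he
  have hqp : ‖q - p‖ = e := by rw [← dist_eq_norm, hp]
  have hL : 0 ≤ t - e := sub_nonneg.2 hqt
  obtain ⟨u₀, hu₀, -⟩ := exists_infDist_ge_of_unique_nearest hMc hMne hM hq hL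
    (by rw [← he]; linarith) one_pos le_rfl
  obtain ⟨u, hu, humax⟩ := (isCompact_sphere q (t - e)).exists_isMaxOn ⟨u₀, hu₀⟩
    (continuous_infDist_pt M).continuousOn
  rw [mem_sphere] at hu
  have hut : t ≤ infDist u M := by
    refine le_of_forall_pos_lt_add fun δ hδ => ?_
    have hη : 0 < min 1 δ := lt_min one_pos hδ
    obtain ⟨w, hw, hwle⟩ := exists_infDist_ge_of_unique_nearest hMc hMne hM hq hL
      (by rw [← he]; linarith) hη (min_le_left _ _)
    have hwu : infDist w M ≤ infDist u M := humax hw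
    have : min 1 δ * (t - e) < δ := by
      nlinarith [min_le_right 1 δ]
    rw [← he] at hwle
    nlinarith
  have hup : dist u p = t := by
    refine le_antisymm ?_ (hut.trans (infDist_le_dist_of_mem hpM))
    have := dist_triangle u q p
    linarith
  have hmid : q = AffineMap.lineMap p u (e / t) := by
    refine eq_lineMap_of_dist_eq_mul_of_dist_eq_mul ?_ ?_
    · rw [dist_comm, hp, dist_comm p u, hup, div_mul_cancel₀ _ (by linarith)]
    · rw [dist_comm, hu, dist_comm p u, hup, sub_mul, div_mul_cancel₀ _ (by linarith), one_mul]
  have hue : p + (t / ‖q - p‖) • (q - p) = u := by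
    rw [hqp]
    conv_lhs => rw [hmid]
    rw [AffineMap.lineMap_apply_module', add_sub_cancel_right, smul_smul,
      div_mul_div_cancel₀ (by linarith), div_self (by linarith), one_smul]
    abel
  rw [hue]
  exact le_antisymm (hup ▸ infDist_le_dist_of_mem hpM) hut

open Filter Topology in
theorem two_mul_inner_le_of_unique_nearest {F : Type*} [NormedAddCommGroup F]
    [InnerProductSpace ℝ F] [ProperSpace F] {M : Set F} (hMc : IsCompact M)
    (hM : ∀ u, infDist u M < 1 → ∀ y ∈ M, ∀ y' ∈ M,
      dist u y = infDist u M → dist u y' = infDist u M → y = y')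
    {q p y : F} (hpM : p ∈ M) (hp : dist q p = infDist q M) (hq : infDist q M < 1) (hy : y ∈ M) :
    2 * inner ℝ (y - p) (q - p) ≤ ‖q - p‖ * ‖y - p‖ ^ 2 := by
  have hqp : ‖q - p‖ = infDist q M := by rw [← dist_eq_norm, hp]
  rcases (norm_nonneg (q - p)).eq_or_lt with h0 | h0
  · rw [← h0, norm_eq_zero.1 h0.symm]; simp
  have key : ∀ t ∈ Ioo ‖q - p‖ 1, 2 * t * inner ℝ (y - p) (q - p) ≤ ‖q - p‖ * ‖y - p‖ ^ 2 := by
    rintro t ⟨ht, ht1⟩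
    have htd := infDist_add_smul_of_unique_nearest hMc hM hpM hp (hqp ▸ h0) (hqp ▸ ht.le) ht1
    have hle := infDist_le_dist_of_mem (x := p + (t / ‖q - p‖) • (q - p)) hy
    rw [htd, dist_comm, dist_eq_norm, ← sub_sub] at hle
    have hsq := pow_le_pow_left₀ (h0.trans ht).le hle 2
    rw [norm_sub_sq_real, real_inner_smul_right, norm_smul, Real.norm_of_nonneg (div_nonneg (h0.trans ht).le h0.le),
      div_mul_cancel₀ _ h0.ne'] at hsq
    have : 2 * (t / ‖q - p‖ * inner ℝ (y - p) (q - p)) ≤ ‖y - p‖ ^ 2 := by linarith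
    have h2 := mul_le_mul_of_nonneg_left this h0.le
    calc _ = ‖q - p‖ * (2 * (t / ‖q - p‖ * inner ℝ (y - p) (q - p))) := by field_simp
      _ ≤ _ := h2
  have hlim : Tendsto (fun t : ℝ => 2 * t * inner ℝ (y - p) (q - p)) (𝓝[<] 1)
      (𝓝 (2 * 1 * inner ℝ (y - p) (q - p))) :=
    ((continuous_const.mul continuous_id).mul continuous_const).continuousWithinAt
  have := le_of_tendsto hlim (mem_of_superset (Ioo_mem_nhdsLT (hqp ▸ hq)) key)
  simpa using this

open Filter Topology in
/-- Federer's bound on the deviation of a set of reach at least one from its tangent cones. -/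
theorem exists_mem_tangentConeAt_norm_sub_le {F : Type*} [NormedAddCommGroup F]
    [InnerProductSpace ℝ F] [ProperSpace F] {M : Set F} (hMc : IsCompact M)
    (hM : ∀ u, infDist u M < 1 → ∀ y ∈ M, ∀ y' ∈ M,
      dist u y = infDist u M → dist u y' = infDist u M → y = y')
    {z y : F} (hz : z ∈ M) (hy : y ∈ M) :
    ∃ w ∈ tangentConeAt ℝ M z, ‖w - (y - z)‖ ≤ ‖y - z‖ ^ 2 / 2 := by
  set L := ‖y - z‖ with hLdef
  have hL : 0 ≤ L := norm_nonneg _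
  let s : ℕ → ℝ := fun n => (L + 1)⁻¹ * (1 / ((n : ℝ) + 1))
  have hs0 : ∀ n, 0 < s n := fun n => by positivity
  have hslim : Tendsto s atTop (𝓝 0) := by
    simpa [s] using (tendsto_one_div_add_atTop_nhds_zero_nat (𝕜 := ℝ)).const_mul (L + 1)⁻¹
  have hsinv : ∀ n, s n ≤ (L + 1)⁻¹ := fun n =>
    mul_le_of_le_one_right (by positivity) (by
      rw [div_le_one (by positivity)]; linarith [(Nat.cast_nonneg n : (0 : ℝ) ≤ n)])
  have hs1 : ∀ n, s n ≤ 1 := fun n => (hsinv n).trans (inv_le_one_of_one_le₀ (by linarith))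
  have hsL : ∀ n, s n * L < 1 := fun n =>
    calc s n * L ≤ (L + 1)⁻¹ * L := mul_le_mul_of_nonneg_right (hsinv n) hL
      _ < 1 := by rw [inv_mul_lt_iff₀ (by positivity)]; linarith
  choose p hpM hp using fun n => hMc.exists_infDist_eq_dist ⟨z, hz⟩ (z + s n • (y - z))
  set e : ℕ → ℝ := fun n => ‖z + s n • (y - z) - p n‖ with he
  have heL : ∀ n, e n ≤ s n * L := fun n => by
    have := infDist_le_dist_of_mem (x := z + s n • (y - z)) hz
    rwa [hp, dist_eq_norm, dist_eq_norm, add_sub_cancel_left, norm_smul,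
      Real.norm_of_nonneg (hs0 n).le] at this
  have hmain : ∀ n, (2 - s n * L) * e n ≤ s n * L ^ 2 := by
    intro n
    have hn0 : 0 ≤ e n := norm_nonneg _
    rcases hn0.eq_or_lt with h0 | h0
    · rw [← h0, mul_zero]; exact mul_nonneg (hs0 n).le (sq_nonneg _)
    have hlt : infDist (z + s n • (y - z)) M < 1 := by
      rw [hp, dist_eq_norm]; exact (heL n).trans_lt (hsL n)
    have h1 := two_mul_inner_le_of_unique_nearest hMc hM (hpM n) (hp n).symm hlt hz
    have h2 := two_mul_inner_le_of_unique_nearest hMc hM (hpM n) (hp n).symm hlt hy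
    have hc : z + s n • (y - z) - p n = (1 - s n) • (z - p n) + s n • (y - p n) := by
      module
    have hyz : y - z = (y - p n) - (z - p n) := by abel
    have hE : e n ^ 2 = (1 - s n) * inner ℝ (z - p n) (z + s n • (y - z) - p n)
        + s n * inner ℝ (y - p n) (z + s n • (y - z) - p n) := by
      rw [← real_inner_smul_left, ← real_inner_smul_left, ← inner_add_left, ← hc,
        real_inner_self_eq_norm_sq]
    have hS : (1 - s n) * ‖z - p n‖ ^ 2 + s n * ‖y - p n‖ ^ 2
        = e n ^ 2 + s n * (1 - s n) * L ^ 2 := by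
      simp only [he, hLdef]
      rw [hc, hyz, norm_add_sq_real, norm_sub_sq_real (y - p n), norm_smul, norm_smul,
        real_inner_smul_left, real_inner_smul_right, mul_pow, mul_pow, Real.norm_eq_abs,
        Real.norm_eq_abs, sq_abs, sq_abs, real_inner_comm (z - p n) (y - p n)]
      ring
    change _ ≤ e n * _ at h1
    change _ ≤ e n * _ at h2
    have h3 : 2 * e n ^ 2 ≤ e n * (e n ^ 2 + s n * (1 - s n) * L ^ 2) := by
      rw [← hS, hE]
      nlinarith [mul_le_mul_of_nonneg_left h1 (sub_nonneg.2 (hs1 n)),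
        mul_le_mul_of_nonneg_left h2 (hs0 n).le]
    have h4 : 2 * e n ≤ e n ^ 2 + s n * (1 - s n) * L ^ 2 :=
      le_of_mul_le_mul_left (by linarith) h0
    have h5 : e n ^ 2 ≤ s n * L * e n := by
      rw [sq]; exact mul_le_mul_of_nonneg_right (heL n) hn0
    nlinarith [mul_nonneg (mul_nonneg (hs0 n).le (hs0 n).le) (sq_nonneg L)]
  have hnorm : ∀ n, ‖(s n)⁻¹ • (p n - z) - (y - z)‖ = (s n)⁻¹ * e n := fun n => by
    have : (s n)⁻¹ • (p n - z) - (y - z) = -((s n)⁻¹ • (z + s n • (y - z) - p n)) := by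
      have hyz : y - z = (s n)⁻¹ • s n • (y - z) := (inv_smul_smul₀ (hs0 n).ne' _).symm
      nth_rewrite 1 [hyz]
      rw [← smul_sub, ← smul_neg]
      congr 1
      abel
    rw [this, norm_neg, norm_smul, Real.norm_of_nonneg (inv_nonneg.2 (hs0 n).le)]
  have hb : ∀ n, (2 - s n * L) * ‖(s n)⁻¹ • (p n - z) - (y - z)‖ ≤ L ^ 2 := fun n => by
    rw [hnorm, mul_left_comm, inv_mul_le_iff₀ (hs0 n)]
    exact hmain n
  have hball : ∀ n, (s n)⁻¹ • (p n - z) ∈ closedBall (y - z) (L ^ 2) := fun n => by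
    rw [mem_closedBall, dist_eq_norm]
    nlinarith [hb n, hsL n, norm_nonneg ((s n)⁻¹ • (p n - z) - (y - z))]
  obtain ⟨w, -, φ, hφ, hw⟩ := (isCompact_closedBall (y - z) (L ^ 2)).tendsto_subseq hball
  refine ⟨w, mem_tangentConeAt_of_seq atTop (fun n => (s (φ n))⁻¹) (fun n => p (φ n) - z) ?_
    (Eventually.of_forall fun n => by rw [add_sub_cancel]; exact hpM _) hw, ?_⟩
  · have := (hslim.comp hφ.tendsto_atTop).smul hw
    rw [zero_smul] at this
    refine this.congr fun n => ?_
    simp only [Function.comp_apply, smul_smul, mul_inv_cancel₀ (hs0 _).ne', one_smul]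
  · have h1 : Tendsto (fun n => (2 - s (φ n) * L) * ‖(s (φ n))⁻¹ • (p (φ n) - z) - (y - z)‖) atTop
        (𝓝 ((2 - 0 * L) * ‖w - (y - z)‖)) :=
      (((hslim.comp hφ.tendsto_atTop).mul_const L).const_sub 2).mul
        (hw.sub tendsto_const_nhds).norm
    have := le_of_tendsto h1 (Eventually.of_forall fun n => hb (φ n))
    linarith

open MeasureTheory in
/-- A finite family of points in a ball of radius `ρ`, at most `κ` of which lie in any ball of
radius `s`, has at most `κ (1 + ρ / s) ^ dim` members. -/
theorem card_le_of_card_closedBall_le {ι E : Type*} [NormedAddCommGroup E] [InnerProductSpace ℝ E]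
    [FiniteDimensional ℝ E] (Q : Finset ι) (f : ι → E) {ρ s : ℝ} (hρ : 0 ≤ ρ) (hs : 0 < s) {κ : ℕ}
    (hf : ∀ p ∈ Q, ‖f p‖ ≤ ρ)
    (hκ : ∀ c : E, (Q.filter fun p => dist c (f p) ≤ s).card ≤ κ) :
    (Q.card : ℝ) ≤ κ * ((ρ + s) / s) ^ Module.finrank ℝ E := by
  borelize E
  let μ : Measure E := volume
  set B := closedBall (0 : E) (ρ + s) with hB
  have hint : ∀ p ∈ Q, ∫⁻ c in B, (closedBall (f p) s).indicator 1 c ∂μ = μ (closedBall 0 s) := by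
    intro p hp
    rw [lintegral_indicator_one isClosed_closedBall.measurableSet,
      Measure.restrict_apply isClosed_closedBall.measurableSet, inter_eq_self_of_subset_left,
      Measure.addHaar_closedBall_center]
    refine closedBall_subset_closedBall' ?_
    rw [dist_zero_right]
    linarith [hf p hp]
  have hsum : (Q.card : ENNReal) * μ (closedBall 0 s) ≤ κ * μ B := by
    calc (Q.card : ENNReal) * μ (closedBall 0 s)
        = ∑ p ∈ Q, ∫⁻ c in B, (closedBall (f p) s).indicator 1 c ∂μ := by
          rw [Finset.sum_congr rfl hint, Finset.sum_const, nsmul_eq_mul]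
      _ = ∫⁻ c in B, ∑ p ∈ Q, (closedBall (f p) s).indicator 1 c ∂μ :=
          (lintegral_finsetSum _ fun p _ =>
            measurable_one.indicator isClosed_closedBall.measurableSet).symm
      _ ≤ ∫⁻ _ in B, κ ∂μ := by
          refine lintegral_mono fun c => ?_
          classical
          simp only [indicator_apply, mem_closedBall, Pi.one_apply]
          rw [Finset.sum_boole]
          exact_mod_cast hκ c
      _ = κ * μ B := by rw [setLIntegral_const]
  rw [hB, Measure.addHaar_closedBall' μ 0 hs.le,
    Measure.addHaar_closedBall' μ 0 (add_nonneg hρ hs.le),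
    ← mul_assoc, ← mul_assoc] at hsum
  have hfin : μ (closedBall 0 1) ≠ ⊤ := measure_closedBall_lt_top.ne
  have hpos : μ (closedBall 0 1) ≠ 0 := (measure_closedBall_pos μ 0 one_pos).ne'
  have hsum' := (ENNReal.mul_le_mul_iff_left hpos hfin).1 hsum
  have hreal := ENNReal.toReal_mono (ENNReal.mul_ne_top (by simp) ENNReal.ofReal_ne_top) hsum'
  rw [ENNReal.toReal_mul, ENNReal.toReal_mul, ENNReal.toReal_ofReal (by positivity),
    ENNReal.toReal_ofReal (by positivity), ENNReal.toReal_natCast, ENNReal.toReal_natCast] at hreal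
  rw [div_pow, ← mul_div_assoc, le_div_iff₀ (by positivity)]
  exact hreal

theorem nine_mul_pow_mul_le (m : ℕ) (hm : 1 ≤ m) :
    (9 * (m : ℝ)) ^ m * (Real.sqrt m / (12 * m)) ^ (2 * m - 1) ≤
      23 * (1 - 3 / (4 * (m : ℝ))) ^ (2 * m - 1) := by
  obtain ⟨k, rfl⟩ := Nat.exists_eq_add_of_le' hm
  have hexp : 2 * (k + 1) - 1 = 2 * k + 1 := by omega
  set x : ℝ := ((k + 1 : ℕ) : ℝ) with hx
  have hx1 : 1 ≤ x := by rw [hx]; exact_mod_cast hm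
  have hx0 : 0 < x := by linarith
  have hsq : Real.sqrt x ^ 2 = x := Real.sq_sqrt hx0.le
  have hlhs : (9 * x) ^ (k + 1) * (Real.sqrt x / (12 * x)) ^ (2 * k + 1)
      = 3 / 4 * Real.sqrt x * (1 / 16) ^ k := by
    rw [pow_succ, pow_succ (Real.sqrt x / (12 * x)), pow_mul, div_pow, hsq]
    have : (1 / 16 : ℝ) = 9 * x * (x / (12 * x) ^ 2) := by field_simp; norm_num
    rw [this, mul_pow _ (x / (12 * x) ^ 2)]
    field_simp
    norm_num
  rw [hexp, hlhs]
  rcases k.eq_zero_or_pos with rfl | hk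
  · norm_num [hx]
  have hx2 : 2 ≤ x := by rw [hx]; exact_mod_cast Nat.succ_le_succ hk
  have ha : 5 / 8 ≤ 1 - 3 / (4 * x) := by
    have : 3 / (4 * x) ≤ 3 / 8 := by gcongr; linarith
    linarith
  have hsx : Real.sqrt x ≤ 2 ^ k := by
    refine (Real.sqrt_le_left hx0.le |>.2 (by nlinarith)).trans ?_
    rw [hx]
    exact_mod_cast k.lt_two_pow_self
  calc 3 / 4 * Real.sqrt x * (1 / 16) ^ k ≤ 3 / 4 * 2 ^ k * (1 / 16) ^ k := by gcongr
    _ = 3 / 4 * (2 / 16) ^ k := by rw [mul_assoc, ← mul_pow]; norm_num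
    _ ≤ 23 * (5 / 8) * ((5 / 8) ^ 2) ^ k := by gcongr <;> norm_num
    _ = 23 * (5 / 8) ^ (2 * k + 1) := by rw [← pow_mul]; ring
    _ ≤ _ := by gcongr

theorem card_filter_closedBall_le (d m κ : ℕ) (hm : 1 ≤ m) (ε : ℝ) (hε : 0 < ε)
    (M : Set (EuclideanSpace ℝ (Fin d))) (hMc : IsCompact M)
    (hM : ∀ u, infDist u M < 1 → ∀ y ∈ M, ∀ y' ∈ M,
      dist u y = infDist u M → dist u y' = infDist u M → y = y')
    (z : EuclideanSpace ℝ (Fin d)) (hz : z ∈ M)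
    (E : Submodule ℝ (EuclideanSpace ℝ (Fin d)))
    (hE : (E : Set (EuclideanSpace ℝ (Fin d))) = tangentConeAt ℝ M z)
    (hEm : Module.finrank ℝ E = m)
    (P : Finset (EuclideanSpace ℝ (Fin d))) (hPM : ↑P ⊆ M)
    (hκ : ∀ x : EuclideanSpace ℝ (Fin d), (P.filter (fun p => dist x p ≤ ε)).card ≤ κ)
    (hsmall : 32 * (m : ℝ) ^ 2 * ε ≤ 1)
    (x : EuclideanSpace ℝ (Fin d)) (hx : dist x z ≤ 2 * ε) :
    ((P.filter (fun p => dist x p ≤ m * (4 * ε))).card : ℝ) ≤ κ * (9 * (m : ℝ)) ^ m := by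
  have hm1 : (1 : ℝ) ≤ m := by exact_mod_cast hm
  set Q := P.filter (fun p => dist x p ≤ m * (4 * ε)) with hQ
  have hρ : ∀ p ∈ Q, ‖p - z‖ ≤ (4 * m + 2) * ε := by
    intro p hp
    have h1 := (Finset.mem_filter.1 hp).2
    have h2 := dist_triangle p x z
    rw [dist_comm p x, dist_eq_norm] at h2
    linarith
  have hperp : ∀ p ∈ Q, ‖p - z - E.starProjection (p - z)‖ ≤ 9 / 16 * ε := by
    intro p hp
    obtain ⟨w, hw, hwle⟩ := exists_mem_tangentConeAt_norm_sub_le hMc hM hz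
      (hPM (Finset.mem_coe.2 (Finset.mem_filter.1 hp).1))
    rw [← hE] at hw
    have hmin : ‖p - z - E.starProjection (p - z)‖ ≤ ‖p - z - w‖ := by
      rw [Submodule.starProjection_minimal]
      exact ciInf_le ⟨0, by rintro _ ⟨v, rfl⟩; exact norm_nonneg _⟩ (⟨w, hw⟩ : E)
    rw [norm_sub_rev] at hwle
    have h6 : ‖p - z‖ ≤ 6 * m * ε := (hρ p hp).trans (by nlinarith)
    have h36 : ‖p - z‖ ^ 2 ≤ (6 * m * ε) ^ 2 := pow_le_pow_left₀ (norm_nonneg _) h6 2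
    nlinarith
  have key := card_le_of_card_closedBall_le Q (fun p => E.orthogonalProjectionOnto (p - z))
    (ρ := (4 * m + 2) * ε) (s := 4 / 5 * ε) (κ := κ) (by positivity) (by positivity)
    (fun p hp => (E.norm_orthogonalProjectionOnto_apply_le _).trans (hρ p hp)) ?_
  · refine key.trans ?_
    rw [hEm]
    gcongr
    rw [div_le_iff₀ (by positivity)]
    nlinarith
  intro c
  refine (Finset.card_le_card ?_).trans (hκ (z + c))
  intro p hp
  obtain ⟨hpQ, hpc⟩ := Finset.mem_filter.1 hp
  refine Finset.mem_filter.2 ⟨(Finset.mem_filter.1 hpQ).1, ?_⟩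
  have hpc' : ‖E.starProjection (p - z) - c‖ ≤ 4 / 5 * ε := by
    rw [dist_comm, dist_eq_norm] at hpc
    exact hpc
  have hpyth : ‖p - (z + c)‖ ^ 2 = ‖E.starProjection (p - z) - c‖ ^ 2
      + ‖p - z - E.starProjection (p - z)‖ ^ 2 := by
    have : p - (z + c) = (E.starProjection (p - z) - c) + (p - z - E.starProjection (p - z)) := by
      abel
    rw [this, sq, sq, sq]
    refine norm_add_sq_eq_norm_sq_add_norm_sq_real ?_
    exact E.inner_right_of_mem_orthogonal
      (E.sub_mem (E.starProjection_apply_mem _) c.2) (E.sub_starProjection_mem_orthogonal _)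
  rw [dist_comm, dist_eq_norm]
  refine le_of_sq_le_sq ?_ hε.le
  have h1 := pow_le_pow_left₀ (norm_nonneg _) hpc' 2
  have h2 := pow_le_pow_left₀ (norm_nonneg _) (hperp p hpQ) 2
  rw [hpyth]
  nlinarith [sq_nonneg ε]

/-- Let `M ⊆ ℝ^d` be a compact smooth `m`-manifold with reach at least 1,
`P` a uniform `(ε,κ)`-sample of `M`, `x` at distance at most `2ε` from `M`, `γ = 4ε`, and
`r = √m·ε/3`.  Then
`Σ_{p ∈ P ∩ B(x,mγ)} (1 − ‖x−p‖/(mγ))^{2m−1}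
  ≤ (23κ+1) · Σ_{p ∈ P ∩ B(x, mγ−r)} (1 − ‖x−p‖/(mγ))^{2m−1}`. -/
theorem stmt11 (d m κ : ℕ) (hm : 1 ≤ m) (ε γ r : ℝ) (hε : 0 < ε) (hγ : γ = 4 * ε)
    (hr : r = Real.sqrt m * ε / 3)
    (M : Set (EuclideanSpace ℝ (Fin d)))
    (hMne : M.Nonempty) (hMc : IsCompact M)
    (T : EuclideanSpace ℝ (Fin d) → Submodule ℝ (EuclideanSpace ℝ (Fin d)))
    (hT : ∀ z ∈ M, (T z : Set (EuclideanSpace ℝ (Fin d))) = tangentConeAt ℝ M z)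
    (hTm : ∀ z ∈ M, Module.finrank ℝ (T z) = m)
    (hreach : ∀ x ∈ medialAxis M, ∀ z ∈ M, 1 ≤ dist x z)
    (P : Finset (EuclideanSpace ℝ (Fin d))) (hPM : ↑P ⊆ M)
    (hdense : ∀ z ∈ M, ∃ p ∈ P, dist z p ≤ ε)
    (hκ : ∀ x : EuclideanSpace ℝ (Fin d), (P.filter (fun p => dist x p ≤ ε)).card ≤ κ)
    (hsmall : 4 * (m : ℝ) ≤ 1 / Real.sqrt (2 * ε))
    (x : EuclideanSpace ℝ (Fin d)) (hx : Metric.infDist x M ≤ 2 * ε) :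
    ∑ p ∈ P.filter (fun p => dist x p ≤ m * γ), (1 - dist x p / (m * γ)) ^ (2 * m - 1) ≤
      (23 * (κ : ℝ) + 1) *
        ∑ p ∈ P.filter (fun p => dist x p ≤ m * γ - r),
          (1 - dist x p / (m * γ)) ^ (2 * m - 1) := by
  subst hγ
  have hm1 : (1 : ℝ) ≤ m := by exact_mod_cast hm
  have hM : ∀ u, infDist u M < 1 → ∀ y ∈ M, ∀ y' ∈ M,
      dist u y = infDist u M → dist u y' = infDist u M → y = y' := by
    intro u hu y hy y' hy' h h'
    by_contra hne
    have := hreach u (subset_closure ⟨y, hy, y', hy', hne, h, h'⟩) y hy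
    linarith
  have hε32 : 32 * (m : ℝ) ^ 2 * ε ≤ 1 := by
    have hsqrt : 0 < Real.sqrt (2 * ε) := Real.sqrt_pos.2 (by positivity)
    rw [le_div_iff₀ hsqrt] at hsmall
    have := pow_le_pow_left₀ (by positivity) hsmall 2
    rw [mul_pow, Real.sq_sqrt (by positivity)] at this
    linarith
  obtain ⟨z, hzM, hz⟩ := hMc.exists_infDist_eq_dist hMne x
  obtain ⟨q, hqP, hq⟩ := hdense z hzM
  have hcard := card_filter_closedBall_le d m κ hm ε hε M hMc hM z hzM (T z) (hT z hzM)
    (hTm z hzM) P hPM hκ hε32 x (hz ▸ hx)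
  have hxq : dist x q ≤ 3 * ε := by linarith [dist_triangle x z q]
  set R : ℝ := m * (4 * ε) with hR
  have hR0 : 0 < R := by positivity
  have hr0 : 0 ≤ r := by rw [hr]; positivity
  have hsm : Real.sqrt m ≤ m := (Real.sqrt_le_left (by positivity)).2 (by nlinarith)
  have hrR : r / R = Real.sqrt m / (12 * m) := by rw [hr, hR]; field_simp; norm_num
  set w : EuclideanSpace ℝ (Fin d) → ℝ := fun p => (1 - dist x p / R) ^ (2 * m - 1) with hw
  have hbase : ∀ p, dist x p ≤ R → 0 ≤ 1 - dist x p / R := fun p hp =>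
    sub_nonneg.2 ((div_le_one hR0).2 hp)
  set S := ∑ p ∈ P.filter (fun p => dist x p ≤ R - r), w p with hS
  have hqR : dist x q ≤ R - r := by
    have : Real.sqrt m * ε ≤ m * ε := mul_le_mul_of_nonneg_right hsm hε.le
    rw [hR, hr]
    nlinarith
  have hqS : (1 - 3 / (4 * (m : ℝ))) ^ (2 * m - 1) ≤ S := by
    have hle : (1 - 3 / (4 * (m : ℝ))) ^ (2 * m - 1) ≤ w q := by
      refine pow_le_pow_left₀ ?_ ?_ _
      · rw [sub_nonneg, div_le_one (by positivity)]; linarith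
      · have : 3 / (4 * (m : ℝ)) = 3 * ε / R := by rw [hR]; field_simp
        rw [this]
        gcongr
    refine hle.trans (Finset.single_le_sum (f := w) (fun p hp => ?_)
      (Finset.mem_filter.2 ⟨hqP, hqR⟩))
    exact pow_nonneg (hbase p (by linarith [(Finset.mem_filter.1 hp).2])) _
  set Q := P.filter (fun p => dist x p ≤ R) with hQ
  have hsub : P.filter (fun p => dist x p ≤ R - r) = Q.filter (fun p => dist x p ≤ R - r) := by
    ext p
    simp only [hQ, Finset.mem_filter]
    exact ⟨fun h => ⟨⟨h.1, by linarith [h.2]⟩, h.2⟩, fun h => ⟨h.1.1, h.2⟩⟩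
  have hann : ∑ p ∈ Q.filter (fun p => ¬ dist x p ≤ R - r), w p
      ≤ Q.card * (Real.sqrt m / (12 * m)) ^ (2 * m - 1) := by
    calc _ ≤ ∑ p ∈ Q.filter (fun p => ¬ dist x p ≤ R - r),
          (Real.sqrt m / (12 * m)) ^ (2 * m - 1) := by
          refine Finset.sum_le_sum fun p hp => ?_
          obtain ⟨hpQ, hpr⟩ := Finset.mem_filter.1 hp
          refine pow_le_pow_left₀ (hbase p (Finset.mem_filter.1 hpQ).2) ?_ _
          rw [← hrR, one_sub_div hR0.ne']
          gcongr
          linarith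
      _ ≤ _ := by
          rw [Finset.sum_const, nsmul_eq_mul]
          gcongr
          exact Finset.filter_subset _ _
  rw [← Finset.sum_filter_add_sum_filter_not Q (fun p => dist x p ≤ R - r), ← hsub]
  have hb : (Q.card : ℝ) * (Real.sqrt m / (12 * m)) ^ (2 * m - 1) ≤ 23 * κ * S := by
    calc _ ≤ κ * (9 * (m : ℝ)) ^ m * (Real.sqrt m / (12 * m)) ^ (2 * m - 1) := by gcongr
      _ = κ * ((9 * (m : ℝ)) ^ m * (Real.sqrt m / (12 * m)) ^ (2 * m - 1)) := by ring
      _ ≤ κ * (23 * (1 - 3 / (4 * (m : ℝ))) ^ (2 * m - 1)) := by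
          exact mul_le_mul_of_nonneg_left (nine_mul_pow_mul_le m hm) (Nat.cast_nonneg κ)
      _ ≤ κ * (23 * S) := by gcongr
      _ = _ := by ring
  calc _ ≤ S + 23 * κ * S := add_le_add le_rfl (hann.trans hb)
    _ = _ := by ring
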